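/- Let τ > 0, κ > 0, and let M, N be real numbers with N > |M|. Then every complex number λ satisfying the characteristic equation λ + κM + κN·exp(−λτ) = 0 has negative real part if and only if κτ·√(N² − M²) < arccos(−M/N). -/

import Mathlib

open Real Complex

/-- The cardinal sine is antitone on `[0, π]`, stated without division. -/
lemma mul_sin_le_mul_sin {u v : ℝ} (hu : 0 ≤ u) (huv : u ≤ v) (hv : v ≤ π) :
    u * Real.sin v ≤ v * Real.sin u := by
  rcases hu.eq_or_lt with rfl | hu'
  · simp
  have hv' : 0 < v := hu'.trans_le huv
  have h := strictConcaveOn_sin_Icc.concaveOn.2 (Set.left_mem_Icc.2 pi_pos.le) ⟨hv'.le, hv⟩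
    (sub_nonneg.2 ((div_le_one hv').2 huv)) (div_nonneg hu hv'.le) (sub_add_cancel 1 (u / v))
  simp only [smul_eq_mul, mul_zero, Real.sin_zero, zero_add] at h
  rw [div_mul_cancel₀ _ hv'.ne', div_mul_eq_mul_div, div_le_iff₀ hv'] at h
  linarith

/-- The function `x ↦ x * cot x` is antitone on `[0, π / 2]`, stated without division. -/
lemma mul_cos_mul_sin_le {u v : ℝ} (hu : 0 ≤ u) (huv : u ≤ v) (hv : v ≤ π / 2) :
    v * Real.cos v * Real.sin u ≤ u * Real.cos u * Real.sin v := by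
  have h := mul_sin_le_mul_sin (u := v - u) (v := v + u) (by linarith) (by linarith) (by linarith)
  rw [Real.sin_add, Real.sin_sub] at h
  linarith

lemma re_neg_of_root_of_nonneg {B θ s Y : ℝ} (hB : 0 < B) (hθ0 : 0 < θ) (hθπ : θ < π)
    (hlt : B * Real.sin θ < θ) (hY : 0 ≤ Y)
    (hre : s + B * Real.exp (-s) * Real.cos Y = B * Real.cos θ)
    (him : Y = B * Real.exp (-s) * Real.sin Y) : s < 0 := by
  by_contra! hs
  have hsin : 0 < Real.sin θ := Real.sin_pos_of_pos_of_lt_pi hθ0 hθπ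
  have he0 : 0 < Real.exp (-s) := Real.exp_pos _
  have he1 : Real.exp (-s) ≤ 1 := Real.exp_le_one_iff.2 (by linarith)
  rcases le_or_gt (Real.cos θ) 0 with hc | hc
  · have hsq : Y ^ 2 ≤ (B * Real.sin θ) ^ 2 := by
      have h1 : (B * Real.cos θ - s) ^ 2 + Y ^ 2 = (B * Real.exp (-s)) ^ 2 := by
        have h2 : B * Real.cos θ - s = B * Real.exp (-s) * Real.cos Y := by linarith
        have h3 : Y ^ 2 = (B * Real.exp (-s) * Real.sin Y) ^ 2 := by rw [← him]
        rw [h2, h3]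
        linear_combination (B * Real.exp (-s)) ^ 2 * Real.sin_sq_add_cos_sq Y
      have h4 : (B * Real.exp (-s)) ^ 2 ≤ B ^ 2 :=
        pow_le_pow_left₀ (by positivity) (by nlinarith) 2
      have h5 : B * Real.cos θ ≤ 0 := mul_nonpos_of_nonneg_of_nonpos hB.le hc
      have h6 : B ^ 2 * (Real.sin θ ^ 2 + Real.cos θ ^ 2) = B ^ 2 := by
        rw [Real.sin_sq_add_cos_sq, mul_one]
      nlinarith [mul_nonneg hs (neg_nonneg.2 h5)]
    have hYθ : Y < θ := (abs_le_of_sq_le_sq' hsq (by positivity)).2.trans_lt hlt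
    have hcos : Real.cos θ < Real.cos Y := Real.cos_lt_cos_of_nonneg_of_le_pi hY hθπ.le hYθ
    have h7 : Real.exp (-s) * Real.cos Y ≤ Real.cos θ := by
      refine le_of_mul_le_mul_left ?_ hB
      linarith
    have h8 : Real.cos Y ≤ 0 := by
      by_contra! h
      have := mul_pos he0 h
      linarith
    nlinarith
  · have hθ2 : θ < π / 2 := by
      by_contra! h
      exact absurd (Real.cos_nonpos_of_pi_div_two_le_of_le h (by linarith)) (not_le.2 hc)
    rcases hY.eq_or_lt with rfl | hY'
    · simp only [Real.cos_zero, mul_one] at hre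
      have hcos1 : Real.cos θ < 1 := by
        have := Real.cos_lt_cos_of_nonneg_of_le_pi le_rfl hθπ.le hθ0
        rwa [Real.cos_zero] at this
      have htan : θ * Real.cos θ < Real.sin θ := by
        have := Real.lt_tan hθ0 hθ2
        rwa [Real.tan_eq_sin_div_cos, lt_div_iff₀ hc] at this
      have hle : Real.exp (-s) ≤ Real.cos θ := by
        refine le_of_mul_le_mul_left ?_ hB
        linarith
      have h1 : s * Real.sin θ ≤ θ * (Real.cos θ - Real.exp (-s)) := by
        have : s * Real.sin θ = B * Real.sin θ * (Real.cos θ - Real.exp (-s)) := by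
          linear_combination Real.sin θ * hre
        rw [this]
        exact mul_le_mul_of_nonneg_right hlt.le (by linarith)
      have h2 : Real.sin θ * Real.exp (-s) ≤ θ * Real.exp (-s) :=
        mul_le_mul_of_nonneg_right (Real.sin_le hθ0.le) he0.le
      have h3 : Real.sin θ * (1 - Real.exp (-s)) ≤ Real.sin θ * s :=
        mul_le_mul_of_nonneg_left (by linarith [Real.add_one_le_exp (-s)]) hsin.le
      linarith
    · have hBπ : B < π / 2 := by
        have h1 := Real.mul_le_sin hθ0.le hθ2.le
        have h2 : B * (2 / π * θ) < θ := (mul_le_mul_of_nonneg_left h1 hB.le).trans_lt hlt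
        have h3 : B * (2 / π) < 1 := by
          refine lt_of_mul_lt_mul_right ?_ hθ0.le
          linarith
        rw [← mul_div_assoc, div_lt_one pi_pos] at h3
        linarith
      have hsinY : 0 < Real.sin Y := by
        by_contra! h
        have := mul_nonpos_of_nonneg_of_nonpos (mul_pos hB he0).le h
        linarith
      have hYB : Y ≤ B * Real.sin Y := by
        have h1 : B * Real.exp (-s) ≤ B := mul_le_of_le_one_right hB.le he1
        have h2 := mul_le_mul_of_nonneg_right h1 hsinY.le
        linarith
      have hYle : Y ≤ B := hYB.trans (mul_le_of_le_one_right hB.le (Real.sin_le_one Y))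
      have hYθ : Y < θ := by
        by_contra! h
        have h1 := mul_sin_le_mul_sin hθ0.le h (by linarith)
        have h2 := mul_le_mul_of_nonneg_left h1 hB.le
        have h3 := mul_lt_mul_of_pos_left hlt hY'
        have h4 := mul_le_mul_of_nonneg_left hYB hθ0.le
        linarith
      have h1 := mul_cos_mul_sin_le hY hYθ.le hθ2.le
      have h2 : s * Real.sin Y + Y * Real.cos Y = B * Real.cos θ * Real.sin Y := by
        linear_combination Real.sin Y * hre + Real.cos Y * him
      have h3 : (s * Real.sin Y + Y * Real.cos Y) * Real.sin θ =
          B * Real.cos θ * Real.sin Y * Real.sin θ := by rw [h2]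
      have h4 := mul_lt_mul_of_pos_right hlt (mul_pos hc hsinY)
      have h5 := mul_nonneg hs (mul_pos hsinY hsin).le
      linarith

lemma re_neg_of_root {B θ s Y : ℝ} (hB : 0 < B) (hθ0 : 0 < θ) (hθπ : θ < π)
    (hlt : B * Real.sin θ < θ)
    (hre : s + B * Real.exp (-s) * Real.cos Y = B * Real.cos θ)
    (him : Y = B * Real.exp (-s) * Real.sin Y) : s < 0 := by
  rcases le_total 0 Y with hY | hY
  · exact re_neg_of_root_of_nonneg hB hθ0 hθπ hlt hY hre him
  · refine re_neg_of_root_of_nonneg (Y := -Y) hB hθ0 hθπ hlt (by linarith) ?_ ?_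
    · rwa [Real.cos_neg]
    · rw [Real.sin_neg]
      linarith

lemma exists_root_re_nonneg {B θ : ℝ} (hB : 0 < B) (hθ0 : 0 < θ) (hθπ : θ < π)
    (hle : θ ≤ B * Real.sin θ) :
    ∃ s Y : ℝ, 0 ≤ s ∧ s + B * Real.exp (-s) * Real.cos Y = B * Real.cos θ ∧
      Y = B * Real.exp (-s) * Real.sin Y := by
  have hB1 : 1 ≤ B := by
    have h := mul_le_mul_of_nonneg_left (Real.sin_le hθ0.le) hB.le
    refine le_of_mul_le_mul_right ?_ hθ0
    linarith
  have hlogB : 0 ≤ Real.log B := Real.log_nonneg hB1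
  rcases le_or_gt (B * Real.cos θ) (Real.log B + 1) with hcase | hcase
  · obtain ⟨Z, ⟨hθZ, hZπ⟩, hZ⟩ : (1 : ℝ) ∈ (fun y => B * Real.sinc y) '' Set.Icc θ π := by
      refine intermediate_value_Icc' hθπ.le
        (Real.continuous_sinc.const_smul B).continuousOn ⟨?_, ?_⟩
      · simp [Real.sinc_of_ne_zero pi_ne_zero]
      · change 1 ≤ B * Real.sinc θ
        rw [Real.sinc_of_ne_zero hθ0.ne', ← mul_div_assoc, one_le_div hθ0]
        exact hle
    simp only at hZ
    have hZ0 : 0 < Z := hθ0.trans_le hθZ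
    have hZsin : B * Real.sin Z = Z := by
      rwa [Real.sinc_of_ne_zero hZ0.ne', ← mul_div_assoc, div_eq_one_iff_eq hZ0.ne'] at hZ
    have hone : ∀ y ∈ Set.Icc 0 Z, 1 ≤ B * Real.sinc y := by
      rintro y ⟨hy0, hyZ⟩
      rcases hy0.eq_or_lt with rfl | hy
      · simpa using hB1
      · rw [Real.sinc_of_ne_zero hy.ne', ← mul_div_assoc, one_le_div hy]
        have h1 := mul_le_mul_of_nonneg_left (mul_sin_le_mul_sin hy0 hyZ hZπ) hB.le
        refine le_of_mul_le_mul_left ?_ hZ0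
        calc Z * y = y * (B * Real.sin Z) := by rw [hZsin, mul_comm]
          _ ≤ Z * (B * Real.sin y) := by linarith
    have hsinc : ∀ y ∈ Set.Icc 0 Z, 0 < Real.sinc y := fun y hy =>
      (pos_iff_pos_of_mul_pos (zero_lt_one.trans_le (hone y hy))).1 hB
    obtain ⟨Y, hYmem, hY⟩ : B * Real.cos θ ∈
        (fun y => Real.log (B * Real.sinc y) + Real.cos y / Real.sinc y) '' Set.Icc 0 Z := by
      refine intermediate_value_Icc' hZ0.le ?_ ⟨?_, ?_⟩
      · refine ContinuousOn.add (ContinuousOn.log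
          (continuous_const.mul Real.continuous_sinc).continuousOn
            fun y hy => (zero_lt_one.trans_le (hone y hy)).ne') ?_
        exact Real.continuous_cos.continuousOn.div Real.continuous_sinc.continuousOn
          fun y hy => (hsinc y hy).ne'
      · have h1 : Real.sinc Z = 1 / B := by
          rw [eq_div_iff hB.ne']
          linarith
        have h2 : Real.cos Z ≤ Real.cos θ := Real.cos_le_cos_of_nonneg_of_le_pi hθ0.le hZπ hθZ
        simp only [hZ, Real.log_one, zero_add]
        rw [h1, div_div_eq_mul_div, div_one, mul_comm]
        exact mul_le_mul_of_nonneg_left h2 hB.le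
      · simpa using hcase
    simp only at hY
    have hpos := hsinc Y hYmem
    have hexp : B * Real.exp (-Real.log (B * Real.sinc Y)) * Real.sinc Y = 1 := by
      rw [Real.exp_neg, Real.exp_log (mul_pos hB hpos)]
      field_simp
    refine ⟨Real.log (B * Real.sinc Y), Y, Real.log_nonneg (hone Y hYmem), ?_, ?_⟩
    · rw [← hY, add_right_inj, eq_div_iff hpos.ne']
      linear_combination Real.cos Y * hexp
    · rcases eq_or_ne Y 0 with h0 | h0
      · simp [h0]
      · have h1 : Real.sin Y = Y * Real.sinc Y := by
          rw [Real.sinc_of_ne_zero h0]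
          field_simp
        rw [h1]
        linear_combination -Y * hexp
  · obtain ⟨s, ⟨hs, -⟩, hsB⟩ : B * Real.cos θ ∈
        (fun s => s + B * Real.exp (-s)) '' Set.Icc (Real.log B) B := by
      refine intermediate_value_Icc (Real.log_le_self hB.le) (by fun_prop) ⟨?_, ?_⟩
      · simp only [Real.exp_neg, Real.exp_log hB, mul_inv_cancel₀ hB.ne']
        exact hcase.le
      · have h1 : B * Real.cos θ ≤ B := mul_le_of_le_one_right hB.le (Real.cos_le_one θ)
        have h2 : 0 < B * Real.exp (-B) := mul_pos hB (Real.exp_pos _)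
        linarith
    exact ⟨s, 0, hlogB.trans hs, by simpa using hsB, by simp⟩

/-- Real and imaginary parts of the characteristic equation, in terms of `z * τ`. -/
lemma characteristic_eq_zero_iff {τ κ M N : ℝ} (hτ : 0 < τ) (z : ℂ) :
    z + (κ : ℂ) * (M : ℂ) + (κ : ℂ) * (N : ℂ) * Complex.exp (-z * (τ : ℂ)) = 0 ↔
      z.re * τ + κ * N * τ * Real.exp (-(z.re * τ)) * Real.cos (z.im * τ) = -(κ * M * τ) ∧
      z.im * τ = κ * N * τ * Real.exp (-(z.re * τ)) * Real.sin (z.im * τ) := by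
  have hre : (-z * (τ : ℂ)).re = -(z.re * τ) := by simp
  have him : (-z * (τ : ℂ)).im = -(z.im * τ) := by simp
  rw [Complex.ext_iff, ← Complex.ofReal_mul, ← Complex.ofReal_mul, Complex.add_re,
    Complex.add_re, Complex.add_im, Complex.add_im, Complex.re_ofReal_mul, Complex.im_ofReal_mul,
    Complex.exp_re, Complex.exp_im, hre, him, Real.cos_neg, Real.sin_neg, Complex.ofReal_re,
    Complex.ofReal_im, Complex.zero_re, Complex.zero_im]
  refine and_congr ⟨fun h => ?_, fun h => ?_⟩ ⟨fun h => ?_, fun h => ?_⟩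
  · linear_combination τ * h
  · refine mul_left_cancel₀ hτ.ne' ?_
    linear_combination h
  · linear_combination τ * h
  · refine mul_left_cancel₀ hτ.ne' ?_
    linear_combination h

/-- For the characteristic equation λ + κM + κN·exp(−λτ) = 0 of the scalar delay
differential equation u'(t) = −κ(M·u(t) + N·u(t−τ)) with τ > 0, κ > 0 and N > |M|,
every root has negative real part iff κτ·√(N² − M²) < arccos(−M/N). -/
theorem stmt0 (τ κ M N : ℝ) (hτ : 0 < τ) (hκ : 0 < κ) (hN : |M| < N) :
    (∀ z : ℂ, z + (κ : ℂ) * (M : ℂ) + (κ : ℂ) * (N : ℂ) * Complex.exp (-z * (τ : ℂ)) = 0 →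
      z.re < 0) ↔
    κ * τ * Real.sqrt (N ^ 2 - M ^ 2) < Real.arccos (-M / N) := by
  have hN0 : 0 < N := (abs_nonneg M).trans_lt hN
  obtain ⟨hM1, hM2⟩ := abs_lt.1 hN
  have hc1 : -1 < -M / N := by rw [lt_div_iff₀ hN0]; linarith
  have hc2 : -M / N < 1 := by rw [div_lt_one hN0]; linarith
  have hB : 0 < κ * N * τ := by positivity
  have hθ0 : 0 < Real.arccos (-M / N) := Real.arccos_pos.2 hc2
  have hθπ : Real.arccos (-M / N) < π := by
    refine (Real.arccos_le_pi _).lt_of_ne fun h => ?_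
    rw [Real.arccos_eq_pi] at h
    linarith
  have hcos : κ * N * τ * Real.cos (Real.arccos (-M / N)) = -(κ * M * τ) := by
    rw [Real.cos_arccos hc1.le hc2.le]
    field_simp
  have hsin : κ * τ * Real.sqrt (N ^ 2 - M ^ 2) =
      κ * N * τ * Real.sin (Real.arccos (-M / N)) := by
    have h : N ^ 2 - M ^ 2 = N ^ 2 * (1 - (-M / N) ^ 2) := by field_simp
    rw [Real.sin_arccos, h, Real.sqrt_mul (sq_nonneg N), Real.sqrt_sq hN0.le]
    ring
  rw [hsin]
  constructor
  · intro h
    by_contra! hle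
    obtain ⟨s, Y, hs, hre, him⟩ := exists_root_re_nonneg hB hθ0 hθπ hle
    refine (h ⟨s / τ, Y / τ⟩ ((characteristic_eq_zero_iff hτ _).2 ?_)).not_ge
      (div_nonneg hs hτ.le)
    simp only [div_mul_cancel₀ _ hτ.ne']
    exact ⟨hre.trans hcos, him⟩
  · intro h z hz
    obtain ⟨hre, him⟩ := (characteristic_eq_zero_iff hτ z).1 hz
    exact neg_of_mul_neg_left
      (re_neg_of_root hB hθ0 hθπ h (hre.trans hcos.symm) him) hτ.le
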